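/- Let α be a circularly ordered type with orientation cocycle Or, and let v₀, v₁, v₂, v₃, v₄ ∈ α be pairwise distinct. Then at least one of the following three alternatives holds: (a) Or(v₀,v₁,v₂) = Or(v₀,v₁,v₃) = Or(v₀,v₁,v₄); (b) Or(v₀,v₁,v₂) = −Or(v₀,v₂,v₄) and Or(v₀,v₂,v₄) = Or(v₀,v₂,v₃); (c) Or(v₀,v₃,v₄) = Or(v₀,v₂,v₄) = Or(v₀,v₁,v₄). -/

import Mathlib

noncomputable section

open Classical in
/-- The orientation cocycle of a circularly ordered type. -/
def orC {α : Type*} [CircularOrder α] (x y z : α) : ℝ :=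
  if sbtw x y z then 1 else if sbtw x z y then -1 else 0

theorem sbtw_or_sbtw_swap {α : Type*} [CircularOrder α] {x a b : α}
    (hxa : x ≠ a) (hxb : x ≠ b) (hab : a ≠ b) : sbtw x a b ∨ sbtw x b a := by
  by_contra! hn
  have hba : btw b a x := btw_iff_not_sbtw.2 hn.1
  have hab' : btw a b x := btw_iff_not_sbtw.2 hn.2
  rcases hba.antisymm (hab'.cyclic_right) with h | h | h
  · exact hab h.symm
  · exact hxa h.symm
  · exact hxb h

theorem orC_eq_one {α : Type*} [CircularOrder α] {x a b : α} (h : sbtw x a b) :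
    orC x a b = 1 :=
  if_pos h

theorem orC_eq_neg_one {α : Type*} [CircularOrder α] {x a b : α} (h : sbtw x b a) :
    orC x a b = -1 := by
  have hn : ¬ sbtw x a b := fun h' => h.not_sbtw h'.cyclic_left
  simp [orC, hn, h]

theorem orC_three_alternatives {α : Type*} [CircularOrder α]
    (v₀ v₁ v₂ v₃ v₄ : α)
    (h : List.Pairwise (· ≠ ·) [v₀, v₁, v₂, v₃, v₄]) :
    (orC v₀ v₁ v₂ = orC v₀ v₁ v₃ ∧ orC v₀ v₁ v₃ = orC v₀ v₁ v₄) ∨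
    (orC v₀ v₁ v₂ = - orC v₀ v₂ v₄ ∧ orC v₀ v₂ v₄ = orC v₀ v₂ v₃) ∨
    (orC v₀ v₃ v₄ = orC v₀ v₂ v₄ ∧ orC v₀ v₂ v₄ = orC v₀ v₁ v₄) := by
  simp only [List.pairwise_cons, List.mem_cons, List.not_mem_nil, or_false, forall_eq_or_imp,
    forall_eq] at h
  obtain ⟨⟨h01, h02, h03, h04⟩, ⟨h12, h13, h14⟩, ⟨h23, h24⟩, h34, -⟩ := h
  have trans {a b c : α} : sbtw v₀ a b → sbtw v₀ b c → sbtw v₀ a c := sbtw_trans_right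
  have irrefl {a : α} : ¬ sbtw v₀ a a := sbtw_irrefl_right
  have key {a b : α} (ha : v₀ ≠ a) (hb : v₀ ≠ b) (hab : a ≠ b) :
      (sbtw v₀ a b ∧ orC v₀ a b = 1) ∨ (sbtw v₀ b a ∧ orC v₀ a b = -1) :=
    (sbtw_or_sbtw_swap ha hb hab).imp (fun h => ⟨h, orC_eq_one h⟩) fun h => ⟨h, orC_eq_neg_one h⟩
  rcases key h01 h02 h12 with ⟨r12, e12⟩ | ⟨r12, e12⟩ <;>
  rcases key h01 h03 h13 with ⟨r13, e13⟩ | ⟨r13, e13⟩ <;>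
  rcases key h01 h04 h14 with ⟨r14, e14⟩ | ⟨r14, e14⟩ <;>
  rcases key h02 h03 h23 with ⟨r23, e23⟩ | ⟨r23, e23⟩ <;>
  rcases key h02 h04 h24 with ⟨r24, e24⟩ | ⟨r24, e24⟩ <;>
  rcases key h03 h04 h34 with ⟨r34, e34⟩ | ⟨r34, e34⟩ <;>
  first
  | norm_num [e12, e13, e14, e23, e24, e34]; done
  | grind
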